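/- arXiv:2009.00313 — 2 statements merged into one kernel-verified Lean document; each statement's English description precedes it below -/
import Mathlib

section
/- There exists a surjective group homomorphism ρ : SL₂(ℤ) → S₇ onto the symmetric group on 7 letters such that ρ(S) is the permutation (1 2)(3 5)(4 6) and ρ(U) is the permutation (2 3 4)(5 6 7). -/
open Matrix MatrixGroups

namespace S7Aux

abbrev GG := SL(2, ℤ) × Equiv.Perm (Fin 7)

def ps : Equiv.Perm (Fin 7) := Equiv.swap (0 : Fin 7) 1 * Equiv.swap 2 4 * Equiv.swap 3 5
def pu : Equiv.Perm (Fin 7) := (Equiv.swap (1 : Fin 7) 2 * Equiv.swap 2 3) *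
          (Equiv.swap 4 5 * Equiv.swap 5 6)

def gs : GG := (ModularGroup.S, ps)
def gu : GG := (ModularGroup.S * ModularGroup.T, pu)
def gz : GG := (-1, 1)

lemma ps_sq : ps * ps = 1 := by decide
lemma pu_cube : pu * (pu * pu) = 1 := by decide

lemma gss : gs * gs = gz := by
  refine Prod.ext ?_ ps_sq
  ext i j
  fin_cases i <;> fin_cases j <;> simp [gs, gz, ModularGroup.coe_S]

lemma guuu : gu * (gu * gu) = gz := by
  refine Prod.ext ?_ pu_cube
  ext i j
  fin_cases i <;> fin_cases j <;> simp [gu, gz, ModularGroup.coe_S, ModularGroup.coe_T, Matrix.mul_apply, Matrix.vecMul, dotProduct, Fin.sum_univ_two]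

lemma gzz : gz * gz = 1 := by
  refine Prod.ext ?_ ?_ <;> simp [gz]

lemma gz_comm (g : GG) : g * gz = gz * g := by
  refine Prod.ext ?_ ?_ <;> simp [gz]

/-- the positive monoid, with letters `-SU` and `-SU²` -/
inductive Mon : GG → Prop
  | one : Mon 1
  | t (m : GG) : Mon m → Mon (gz * (gs * (gu * m)))
  | l (m : GG) : Mon m → Mon (gz * (gs * (gu * (gu * m))))

def sg (n : Fin 2) : GG := if n = 0 then 1 else gz
def ua (n : Fin 3) : GG := if n = 0 then 1 else if n = 1 then gu else gu * gu
def sb (n : Fin 2) : GG := if n = 0 then 1 else gs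

def NF (g : GG) : Prop := ∃ n a b m, Mon m ∧ g = sg n * (ua a * (m * sb b))

lemma NF_z {g : GG} (h : NF g) : NF (gz * g) := by
  obtain ⟨n, a, b, m, hm, rfl⟩ := h
  refine ⟨n + 1, a, b, m, hm, ?_⟩
  fin_cases n
  · simp [sg]
  · simp [sg, ← mul_assoc, gzz]

lemma gz_left (g h : GG) : g * (gz * h) = gz * (g * h) := by
  rw [← mul_assoc, gz_comm, mul_assoc]

lemma NF_z_iff {g : GG} (h : NF (gz * g)) : NF g := by
  have := NF_z h
  rwa [← mul_assoc, gzz, one_mul] at this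

lemma NF_of_ua (a b m) (hm : Mon m) : NF (ua a * (m * sb b)) :=
  ⟨0, a, b, m, hm, by simp [sg]⟩

lemma NF_u {g : GG} (h : NF g) : NF (gu * g) := by
  obtain ⟨n, a, b, m, hm, rfl⟩ := h
  have key : NF (gu * (ua a * (m * sb b))) := by
    fin_cases a
    · simpa [ua] using NF_of_ua 1 b m hm
    · simpa [ua, mul_assoc] using NF_of_ua 2 b m hm
    · have := NF_z (NF_of_ua 0 b m hm)
      rw [← guuu] at this
      simpa [ua, mul_assoc] using this
  fin_cases n
  · simpa [sg] using key
  · simpa [sg, gz_left] using NF_z key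

lemma NF_s {g : GG} (h : NF g) : NF (gs * g) := by
  obtain ⟨n, a, b, m, hm, rfl⟩ := h
  have key : NF (gs * (ua a * (m * sb b))) := by
    have gss' : ∀ x, gs * (gs * x) = gz * x := fun x => by rw [← mul_assoc, gss]
    have gzz' : ∀ x, gz * (gz * x) = x := fun x => by rw [← mul_assoc, gzz, one_mul]
    fin_cases a
    · cases hm with
      | one =>
        fin_cases b
        · simpa [ua, sb] using NF_of_ua 0 1 1 Mon.one
        · simpa [ua, sb, gss] using NF_z (NF_of_ua 0 0 1 Mon.one)
      | t m hm =>
        simpa [ua, mul_assoc, gz_left, gss', gzz'] using NF_of_ua 1 b m hm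
      | l m hm =>
        simpa [ua, mul_assoc, gz_left, gss', gzz'] using NF_of_ua 2 b m hm
    · apply NF_z_iff
      simpa [ua, mul_assoc] using NF_of_ua 0 b _ (Mon.t m hm)
    · apply NF_z_iff
      simpa [ua, mul_assoc] using NF_of_ua 0 b _ (Mon.l m hm)
  fin_cases n
  · simpa [sg] using key
  · simpa [sg, gz_left] using NF_z key

lemma Mon_pos {m : GG} (h : Mon m) :
    (∀ i j, 0 ≤ m.1 i j) ∧ (m.1 = 1 → m.2 = 1) := by
  induction h with
  | one => 
    refine ⟨?_, fun _ => rfl⟩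
    intro i j
    fin_cases i <;> fin_cases j <;> simp
  | t m hm ih =>
    have h00 := ih.1 0 0
    have h01 := ih.1 0 1
    have h10 := ih.1 1 0
    have h11 := ih.1 1 1
    constructor
    · intro i j
      fin_cases i <;> fin_cases j <;>
        simp [gz, gs, gu, ModularGroup.coe_S, ModularGroup.coe_T, Matrix.mul_apply, Matrix.vecMul, dotProduct, Fin.sum_univ_two] <;> omega
    · intro h
      exfalso
      have e (i j) := congrArg (fun A : SL(2, ℤ) => A i j) h
      have e00 := e 0 0
      have e01 := e 0 1
      have e10 := e 1 0
      have e11 := e 1 1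
      simp [gz, gs, gu, ModularGroup.coe_S, ModularGroup.coe_T, Matrix.mul_apply, Matrix.vecMul, dotProduct, Fin.sum_univ_two] at e00 e01 e10 e11
      omega
  | l m hm ih =>
    have h00 := ih.1 0 0
    have h01 := ih.1 0 1
    have h10 := ih.1 1 0
    have h11 := ih.1 1 1
    constructor
    · intro i j
      fin_cases i <;> fin_cases j <;>
        simp [gz, gs, gu, ModularGroup.coe_S, ModularGroup.coe_T, Matrix.mul_apply, Matrix.vecMul, dotProduct, Fin.sum_univ_two] <;> omega
    · intro h
      exfalso
      have e (i j) := congrArg (fun A : SL(2, ℤ) => A i j) h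
      have e00 := e 0 0
      have e01 := e 0 1
      have e10 := e 1 0
      have e11 := e 1 1
      simp [gz, gs, gu, ModularGroup.coe_S, ModularGroup.coe_T, Matrix.mul_apply, Matrix.vecMul, dotProduct, Fin.sum_univ_two] at e00 e01 e10 e11
      omega

lemma NF_one {g : GG} (h : NF g) (hg : g.1 = 1) : g.2 = 1 := by
  obtain ⟨n, a, b, m, hm, rfl⟩ := h
  obtain ⟨h0, h1⟩ := Mon_pos hm
  have h00 := h0 0 0
  have h01 := h0 0 1
  have h10 := h0 1 0
  have h11 := h0 1 1
  have hd := m.1.2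
  rw [Matrix.det_fin_two] at hd
  by_cases hc : n = 0 ∧ a = 0 ∧ b = 0
  · obtain ⟨rfl, rfl, rfl⟩ := hc
    simp [sg, ua, sb] at hg ⊢
    exact h1 hg
  · exfalso
    have e (i j) := congrArg (fun A : SL(2, ℤ) => A i j) hg
    have e00 := e 0 0
    have e01 := e 0 1
    have e10 := e 1 0
    have e11 := e 1 1
    clear e hg h1 h0 hd
    fin_cases n <;> fin_cases a <;> fin_cases b <;>
      simp [sg, ua, sb, gz, gs, gu, ModularGroup.coe_S, ModularGroup.coe_T, Matrix.mul_apply, Matrix.vecMul, dotProduct, Fin.sum_univ_two] at e00 e01 e10 e11 hc <;> omega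

def R : Subgroup GG := Subgroup.closure {gs, gu}

lemma R_NF {g : GG} (h : g ∈ R) : NF g := by
  have is : gs⁻¹ = gz * gs := by
    rw [inv_eq_iff_mul_eq_one, gz_left, gss, gzz]
  have iu : gu⁻¹ = gz * (gu * gu) := by
    rw [inv_eq_iff_mul_eq_one, gz_left, guuu, gzz]
  induction h using Subgroup.closure_induction_left with
  | one => simpa [ua, sb] using NF_of_ua 0 0 1 Mon.one
  | mul_left x hx y hy ih =>
    rcases hx with rfl | rfl
    · exact NF_s ih
    · exact NF_u ih
  | inv_mul_cancel x hx y hy ih =>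
    rcases hx with rfl | rfl
    · rw [is, mul_assoc]; exact NF_z (NF_s ih)
    · rw [iu, mul_assoc, mul_assoc]; exact NF_z (NF_u (NF_u ih))

lemma gs_mem : gs ∈ R := Subgroup.subset_closure (by simp)
lemma gu_mem : gu ∈ R := Subgroup.subset_closure (by simp)

def pr : R →* SL(2, ℤ) := (MonoidHom.fst _ _).comp R.subtype

lemma pr_bij : Function.Bijective pr := by
  constructor
  · rw [injective_iff_map_eq_one]
    intro a ha
    exact Subtype.ext (Prod.ext ha (NF_one (R_NF a.2) ha))
  · rw [← MonoidHom.range_eq_top, eq_top_iff, ← SpecialLinearGroup.SL2Z_generators,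
      Subgroup.closure_le]
    have hs : ModularGroup.S ∈ pr.range := ⟨⟨gs, gs_mem⟩, rfl⟩
    have hu : ModularGroup.S * ModularGroup.T ∈ pr.range := ⟨⟨gu, gu_mem⟩, rfl⟩
    rintro x (rfl | rfl)
    · exact hs
    · exact (Subgroup.mul_mem_cancel_left _ hs).1 hu

noncomputable def rho : SL(2, ℤ) →* Equiv.Perm (Fin 7) :=
  ((MonoidHom.snd _ _).comp R.subtype).comp (MulEquiv.ofBijective pr pr_bij).symm.toMonoidHom

lemma rho_eq (g : GG) (h : g ∈ R) : rho g.1 = g.2 := by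
  have : (MulEquiv.ofBijective pr pr_bij).symm g.1 = ⟨g, h⟩ := by
    rw [MulEquiv.symm_apply_eq]; rfl
  simp [rho, this]

def c7 : Equiv.Perm (Fin 7) := ps * pu * ps * pu * ps * pu * pu * ps * pu * pu
def c5 : Equiv.Perm (Fin 7) := ps * pu * ps * pu * ps * pu * pu

set_option maxRecDepth 100000 in
lemma c7_order : orderOf c7 = 7 :=
  haveI : Fact (Nat.Prime 7) := ⟨by norm_num⟩
  orderOf_eq_prime (by decide) (by decide)

set_option maxRecDepth 100000 in
lemma closure_top : Subgroup.closure ({c7, c5 ^ 5} : Set (Equiv.Perm (Fin 7))) = ⊤ := by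
  apply Equiv.Perm.closure_prime_cycle_swap
  · simp; norm_num
  · apply Equiv.Perm.isCycle_of_prime_order'
    · rw [c7_order]; norm_num
    · rw [c7_order]; simp
  · decide
  · unfold Equiv.Perm.IsSwap
    decide

end S7Aux

open S7Aux in
/-- There is a surjective homomorphism `ρ : SL₂(ℤ) → S₇` with
`ρ(S) = (1 2)(3 5)(4 6)` and `ρ(U) = (2 3 4)(5 6 7)`, where the letters
`1,…,7` are represented by `0,…,6 : Fin 7`. -/
theorem exists_surjection_SL2Z_onto_S7 :
    ∃ ρ : SL(2, ℤ) →* Equiv.Perm (Fin 7),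
      Function.Surjective ρ ∧
      ρ ModularGroup.S =
        Equiv.swap (0 : Fin 7) 1 * Equiv.swap 2 4 * Equiv.swap 3 5 ∧
      ρ (ModularGroup.S * ModularGroup.T) =
        (Equiv.swap (1 : Fin 7) 2 * Equiv.swap 2 3) *
          (Equiv.swap 4 5 * Equiv.swap 5 6) := by
  refine ⟨rho, ?_, rho_eq gs gs_mem, rho_eq gu gu_mem⟩
  rw [← MonoidHom.range_eq_top, eq_top_iff, ← closure_top, Subgroup.closure_le]
  have hs : ps ∈ rho.range := ⟨_, rho_eq gs gs_mem⟩
  have hu : pu ∈ rho.range := ⟨_, rho_eq gu gu_mem⟩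
  have h7 : c7 ∈ rho.range := by
    unfold c7
    repeat' first | with_reducible exact hs | with_reducible exact hu | with_reducible apply mul_mem
  have h5 : c5 ∈ rho.range := by
    unfold c5
    repeat' first | with_reducible exact hs | with_reducible exact hu | with_reducible apply mul_mem
  rintro x (rfl | rfl)
  · exact h7
  · exact pow_mem h5 5
end

section
/- Fix m ≥ 1. There are only finitely many perfect m-dimensional positive definite quadratic forms with minimum 1, up to GL_m(ℤ)-equivalence: there exists a finite set F of real symmetric positive definite m×m matrices, each perfect with minimum 1, such that every real symmetric positive definite m×m matrix Q that is perfect with min(Q) = 1 can be written Q = A·Q'·Aᵀ for some Q' ∈ F and some matrix A ∈ GL_m(ℤ) (an integer matrix with determinant ±1). -/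
open Matrix

/-- The value `Q[v] = vᵀQv` of the quadratic form attached to a real matrix
`Q` at an integer vector `v`. -/
def quadVal {m : ℕ} (Q : Matrix (Fin m) (Fin m) ℝ) (v : Fin m → ℤ) : ℝ :=
  (fun i => (v i : ℝ)) ⬝ᵥ Q.mulVec fun i => (v i : ℝ)

/-- `Q` is a symmetric positive definite matrix whose integer minimum is `1`
and which is perfect: the only real symmetric matrix `P` with `P[v] = 1` for
all `v ∈ Min(Q)` is `Q` itself. -/
def IsPerfectMinOne {m : ℕ} (Q : Matrix (Fin m) (Fin m) ℝ) : Prop :=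
  Q.IsSymm ∧ Q.PosDef ∧
  (∀ v : Fin m → ℤ, v ≠ 0 → 1 ≤ quadVal Q v) ∧
  (∃ v : Fin m → ℤ, v ≠ 0 ∧ quadVal Q v = 1) ∧
  (∀ P : Matrix (Fin m) (Fin m) ℝ, P.IsSymm →
    (∀ v : Fin m → ℤ, v ≠ 0 → quadVal Q v = 1 → quadVal P v = 1) → P = Q)

lemma vf_cast_mulVec {m : ℕ} (V : Matrix (Fin m) (Fin m) ℤ) (w : Fin m → ℤ) :
    (fun i => ((V *ᵥ w) i : ℝ)) = (V.map fun x => (x : ℝ)) *ᵥ fun i => (w i : ℝ) := by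
  ext i
  simp [Matrix.mulVec, dotProduct]

lemma vf_sumsq {m : ℕ} {Q : Matrix (Fin m) (Fin m) ℝ} (hQ : Q.PosDef) :
    ∃ (n : ℕ) (b : Fin n → Fin m → ℝ), ∀ x : Fin m → ℝ, x ⬝ᵥ Q *ᵥ x = ∑ k, (b k ⬝ᵥ x) ^ 2 := by
  obtain ⟨n, b, hb⟩ := Matrix.posSemidef_iff_eq_sum_vecMulVec.mp hQ.posSemidef
  refine ⟨n, b, fun x => ?_⟩
  rw [hb, Matrix.sum_mulVec, dotProduct_sum]
  refine Finset.sum_congr rfl fun k _ => ?_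
  have : star (b k) = b k := by ext; simp
  rw [this, Matrix.vecMulVec_mulVec]
  simp [dotProduct_smul, dotProduct_comm, sq]

lemma vf_norm {m : ℕ} {Q : Matrix (Fin m) (Fin m) ℝ} (hQ : Q.PosDef)
    (V : Matrix (Fin m) (Fin m) ℤ) (hV : ∀ j, quadVal Q (fun i => V i j) = 1) (d : Fin m → ℝ)
    (u : Fin m → ℤ) (hu : (fun i => (u i : ℝ)) = (V.map fun x => (x : ℝ)) *ᵥ d) :
    quadVal Q u ≤ m * ∑ i, d i ^ 2 := by
  obtain ⟨n, b, hb⟩ := vf_sumsq hQ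
  unfold quadVal at *
  simp only [hb] at hV
  rw [hb, hu]
  have h1 : ∀ k, (b k ⬝ᵥ (V.map fun x => (x : ℝ)) *ᵥ d) ^ 2
      ≤ m * ∑ j, d j ^ 2 * (b k ⬝ᵥ fun i => (V i j : ℝ)) ^ 2 := by
    intro k
    have e : (b k ⬝ᵥ (V.map fun x => (x : ℝ)) *ᵥ d)
        = ∑ j, d j * (b k ⬝ᵥ fun i => (V i j : ℝ)) := by
      rw [Matrix.dotProduct_mulVec, dotProduct_comm]
      rfl
    rw [e]
    refine sq_sum_le_card_mul_sum_sq.trans ?_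
    simp [mul_pow]
  refine (Finset.sum_le_sum fun k _ => h1 k).trans ?_
  rw [← Finset.mul_sum, Finset.sum_comm]
  simp [← Finset.mul_sum, hV]

lemma vf_det_bound {m : ℕ} {Q : Matrix (Fin m) (Fin m) ℝ} (hQ : Q.PosDef)
    (hmin : ∀ v : Fin m → ℤ, v ≠ 0 → 1 ≤ quadVal Q v)
    (V : Matrix (Fin m) (Fin m) ℤ) (hV : ∀ j, quadVal Q (fun i => V i j) = 1) :
    V.det.natAbs ≤ (m + 1) ^ m := by
  by_cases hD : V.det = 0
  · simp [hD]
  have hDR : (V.det : ℝ) ≠ 0 := by exact_mod_cast hD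
  have hinj : Function.Injective V.mulVecLin := by
    intro x y h
    simp only [Matrix.mulVecLin_apply] at h
    have := congrArg (V.adjugate *ᵥ ·) h
    simp only [Matrix.mulVec_mulVec, Matrix.adjugate_mul, Matrix.smul_mulVec, Matrix.one_mulVec]
      at this
    exact smul_right_injective _ hD this
  set N := LinearMap.range V.mulVecLin with hN
  have hcard : V.det.natAbs = Nat.card ((Fin m → ℤ) ⧸ N) := by
    rw [← Submodule.natAbs_det_equiv N (LinearEquiv.ofInjective _ hinj)]
    rw [← LinearMap.det_toLin']
    rfl
  rw [hcard]
  let X : (Fin m → ℤ) → Fin m → ℝ := fun w i => ((V.adjugate *ᵥ w) i : ℝ) / V.det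
  have hX : ∀ w, (V.map fun x => (x : ℝ)) *ᵥ X w = fun i => (w i : ℝ) := by
    intro w
    have e : X w = (V.det : ℝ)⁻¹ • fun i => ((V.adjugate *ᵥ w) i : ℝ) := by
      ext i; simp [X, div_eq_inv_mul]
    rw [e, Matrix.mulVec_smul, ← vf_cast_mulVec, Matrix.mulVec_mulVec, Matrix.mul_adjugate]
    ext i
    simp [hDR]
  let f : ((Fin m → ℤ) ⧸ N) → (Fin m → Fin (m + 1)) := fun q i =>
    ⟨⌊(m + 1 : ℝ) * Int.fract (X q.out i)⌋₊, by
      rw [Nat.floor_lt (by positivity)]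
      have := Int.fract_lt_one (X q.out i)
      push_cast
      nlinarith⟩
  have hf : Function.Injective f := by
    intro p q hpq
    rw [← p.out_eq, ← q.out_eq]
    refine (Submodule.Quotient.eq N).mpr ?_
    let z : Fin m → ℤ := fun i => ⌊X p.out i⌋ - ⌊X q.out i⌋
    let d : Fin m → ℝ := fun i => Int.fract (X p.out i) - Int.fract (X q.out i)
    let u : Fin m → ℤ := p.out - q.out - V *ᵥ z
    have hu : (fun i => (u i : ℝ)) = (V.map fun x => (x : ℝ)) *ᵥ d := by
      have e : d = X p.out - X q.out - fun i => (z i : ℝ) := by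
        ext i
        simp only [d, z, Int.fract, Pi.sub_apply]
        push_cast
        ring
      rw [e, Matrix.mulVec_sub, Matrix.mulVec_sub, hX, hX, ← vf_cast_mulVec]
      ext i
      simp [u]
    have hd : ∀ i, d i ^ 2 ≤ (1 / (m + 1 : ℝ)) ^ 2 := by
      intro i
      have h := congrArg Fin.val (congrFun hpq i)
      simp only [f] at h
      have a0 : (0:ℝ) < m + 1 := by positivity
      have a1 := Nat.floor_le (a := (m + 1 : ℝ) * Int.fract (X p.out i)) (by positivity)
      have a2 := Nat.lt_floor_add_one ((m + 1 : ℝ) * Int.fract (X p.out i))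
      have a3 := Nat.floor_le (a := (m + 1 : ℝ) * Int.fract (X q.out i)) (by positivity)
      have a4 := Nat.lt_floor_add_one ((m + 1 : ℝ) * Int.fract (X q.out i))
      rw [h] at a1 a2
      apply sq_le_sq'
      · rw [← neg_div, div_le_iff₀ a0]; simp only [d]; nlinarith
      · rw [le_div_iff₀ a0]; simp only [d]; nlinarith
    have hlt : quadVal Q u < 1 := by
      refine (vf_norm hQ V hV d u hu).trans_lt ?_
      have : ∑ i, d i ^ 2 ≤ m * (1 / (m + 1 : ℝ)) ^ 2 := by
        refine (Finset.sum_le_sum fun i _ => hd i).trans ?_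
        simp
      have hm0 : (0:ℝ) ≤ m := by positivity
      refine (mul_le_mul_of_nonneg_left this hm0).trans_lt ?_
      rw [one_div, inv_pow, ← mul_assoc, ← div_eq_mul_inv, div_lt_one (by positivity)]
      nlinarith
    have hu0 : u = 0 := by
      by_contra h
      exact absurd (hmin u h) (not_le.mpr hlt)
    exact ⟨z, by simpa using (sub_eq_zero.mp hu0).symm⟩
  have := Nat.card_le_card_of_injective f hf
  simpa using this

lemma vf_exists_basis {m : ℕ} {Q : Matrix (Fin m) (Fin m) ℝ} (h : IsPerfectMinOne Q) :
    ∃ V : Matrix (Fin m) (Fin m) ℤ, V.det ≠ 0 ∧ ∀ j, quadVal Q (fun i => V i j) = 1 := by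
  obtain ⟨hs, hp, -, -, hperf⟩ := h
  let c : (Fin m → ℤ) → (Fin m → ℝ) := fun v i => (v i : ℝ)
  let S : Set (Fin m → ℝ) := c '' {v | quadVal Q v = 1}
  have hspan : ⊤ ≤ Submodule.span ℝ S := by
    by_contra hne
    obtain ⟨φ, hφ, hle⟩ := Submodule.exists_le_ker_of_lt_top (Submodule.span ℝ S)
      (lt_top_iff_ne_top.mpr fun e => hne e.ge)
    let a : Fin m → ℝ := fun i => φ (Pi.single i 1)
    have ha : ∀ x, φ x = a ⬝ᵥ x := by
      intro x
      rw [LinearMap.pi_apply_eq_sum_univ φ x]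
      simp only [dotProduct, a, smul_eq_mul]
      refine Finset.sum_congr rfl fun i _ => ?_
      rw [mul_comm]
      congr 2
      ext j
      simp [Pi.single_apply, eq_comm]
    have hP := hperf (Q + Matrix.vecMulVec a a) (hs.add (by
      ext i j; simp [Matrix.vecMulVec_apply, mul_comm])) (fun v _ hv => by
        have h0 : a ⬝ᵥ c v = 0 := by
          rw [← ha]; exact hle (Submodule.subset_span ⟨v, hv, rfl⟩)
        have : quadVal (Q + Matrix.vecMulVec a a) v = quadVal Q v := by
          unfold quadVal
          rw [Matrix.add_mulVec, Matrix.vecMulVec_mulVec]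
          change c v ⬝ᵥ (_ + MulOpposite.op (a ⬝ᵥ c v) • a) = _
          rw [h0]; simp [c]
        rw [this, hv])
    have h2 : Matrix.vecMulVec a a = 0 := by simpa using hP
    apply hφ
    ext i
    have := congrFun (congrFun h2 i) i
    simpa [Matrix.vecMulVec_apply, a] using this
  let b := Module.Basis.ofSpan hspan
  have hb : Set.range b ⊆ S := Module.Basis.ofSpan_subset hspan
  let b' : Module.Basis (Fin m) ℝ (Fin m → ℝ) := b.reindex
    (b.indexEquiv (Pi.basisFun ℝ (Fin m)))
  have hb' : ∀ j, ∃ v : Fin m → ℤ, quadVal Q v = 1 ∧ c v = b' j := by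
    intro j
    have : b' j ∈ S := hb (by simp [b'])
    exact this
  choose v hv1 hv2 using hb'
  refine ⟨(Matrix.of v)ᵀ, ?_, fun j => hv1 j⟩
  rw [Matrix.det_transpose]
  have h1 : IsUnit ((Matrix.of v).map (Int.cast : ℤ → ℝ)) := by
    rw [← Matrix.linearIndependent_rows_iff_isUnit]
    have e : ((Matrix.of v).map (Int.cast : ℤ → ℝ)).row = b' := by
      ext j i
      rw [← hv2]
      rfl
    rw [e]
    exact b'.linearIndependent
  have h2 := (Matrix.isUnit_iff_isUnit_det _).mp h1
  intro h0
  have := Int.cast_det (R := ℝ) (Matrix.of v)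
  rw [h0] at this
  simp [← this] at h2

lemma vf_equiv {m : ℕ} {Q₁ Q₂ : Matrix (Fin m) (Fin m) ℝ} (h₁ : IsPerfectMinOne Q₁)
    (h₂ : IsPerfectMinOne Q₂) (V₁ V₂ : Matrix (Fin m) (Fin m) ℤ) (hD : V₁.det ≠ 0)
    (hdet : V₁.det = V₂.det) (hmod : ∀ i j, V₁ i j % V₁.det = V₂ i j % V₂.det)
    (hT : (V₁.adjugate *ᵥ ·) '' {v | quadVal Q₁ v = 1} =
      (V₂.adjugate *ᵥ ·) '' {v | quadVal Q₂ v = 1}) :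
    ∃ A : Matrix (Fin m) (Fin m) ℤ, (A.det = 1 ∨ A.det = -1) ∧
      Q₁ = (A.map fun x => (x : ℝ)) * Q₂ * (A.map fun x => (x : ℝ))ᵀ := by
  have hX : ∀ i j, ∃ x, V₂ i j - V₁ i j = V₁.det * x := by
    intro i j
    have := hmod i j
    rw [← hdet] at this
    exact Int.ModEq.dvd this
  choose X hX using hX
  let U : Matrix (Fin m) (Fin m) ℤ := 1 + Matrix.of X * V₁.adjugate
  have hU : U * V₁ = V₂ := by
    simp only [U, add_mul, one_mul, mul_assoc, Matrix.adjugate_mul, Matrix.mul_smul, mul_one]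
    ext i j
    have := hX i j
    simp only [Matrix.add_apply, Matrix.smul_apply, Matrix.of_apply, smul_eq_mul]
    linarith
  have hUdet : U.det = 1 := by
    have := congrArg Matrix.det hU
    rw [Matrix.det_mul, ← hdet] at this
    exact mul_right_cancel₀ hD (by rw [this, one_mul])
  have hadj : V₁.adjugate = V₂.adjugate * U := by
    have h3 : V₂ * V₁.adjugate = V₁.det • U := by
      rw [← hU, mul_assoc, Matrix.mul_adjugate, Matrix.mul_smul, mul_one]
    have h4 := congrArg (V₂.adjugate * ·) h3
    simp only [← mul_assoc, Matrix.adjugate_mul, ← hdet, Matrix.smul_mul, one_mul,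
      Matrix.mul_smul] at h4
    exact smul_right_injective _ hD h4
  have hinj : ∀ x y : Fin m → ℤ, V₂.adjugate *ᵥ x = V₂.adjugate *ᵥ y → x = y := by
    intro x y h
    have := congrArg (V₂ *ᵥ ·) h
    simp only [Matrix.mulVec_mulVec, Matrix.mul_adjugate, Matrix.smul_mulVec, Matrix.one_mulVec]
      at this
    exact smul_right_injective _ (hdet ▸ hD) this
  have hmap : ∀ w, quadVal Q₁ w = 1 → quadVal Q₂ (U *ᵥ w) = 1 := by
    intro w hw
    have : V₁.adjugate *ᵥ w ∈ (V₂.adjugate *ᵥ ·) '' {v | quadVal Q₂ v = 1} := by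
      rw [← hT]; exact ⟨w, hw, rfl⟩
    obtain ⟨w', hw', e⟩ := this
    simp only [hadj, ← Matrix.mulVec_mulVec] at e
    rw [← hinj _ _ e]
    exact hw'
  refine ⟨Uᵀ, by simp [hUdet], ?_⟩
  symm
  have htr : (Uᵀ.map fun x => (x : ℝ))ᵀ = U.map fun x => (x : ℝ) := rfl
  have htr' : (Uᵀ.map fun x => (x : ℝ)) = (U.map fun x => (x : ℝ))ᵀ := rfl
  rw [htr, htr']
  apply h₁.2.2.2.2
  · have := h₂.1
    unfold Matrix.IsSymm at *
    simp [Matrix.transpose_mul, this, mul_assoc]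
  · intro v _ hv
    rw [← hmap v hv]
    unfold quadVal
    rw [vf_cast_mulVec, mul_assoc, ← Matrix.mulVec_mulVec, ← Matrix.mulVec_mulVec,
      Matrix.dotProduct_mulVec, Matrix.vecMul_transpose]

/-- Voronoi finiteness: up to the action `Q ↦ AQAᵀ` of `GL_m(ℤ)`, there are
only finitely many perfect positive definite `m`-dimensional forms with
minimum `1`. -/
theorem voronoi_finiteness (m : ℕ) (hm : 1 ≤ m) :
    ∃ F : Finset (Matrix (Fin m) (Fin m) ℝ),
      (∀ Q ∈ F, IsPerfectMinOne Q) ∧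
      ∀ Q : Matrix (Fin m) (Fin m) ℝ, IsPerfectMinOne Q →
        ∃ Q' ∈ F, ∃ A : Matrix (Fin m) (Fin m) ℤ,
          (A.det = 1 ∨ A.det = -1) ∧
          Q = (A.map fun x => (x : ℝ)) * Q' * (A.map fun x => (x : ℝ))ᵀ := by
  classical
  have hex : ∀ Q : Matrix (Fin m) (Fin m) ℝ, ∃ V : Matrix (Fin m) (Fin m) ℤ, IsPerfectMinOne Q →
      V.det ≠ 0 ∧ ∀ j, quadVal Q (fun i => V i j) = 1 := by
    intro Q
    by_cases h : IsPerfectMinOne Q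
    · obtain ⟨V, hV⟩ := vf_exists_basis h
      exact ⟨V, fun _ => hV⟩
    · exact ⟨0, fun h' => absurd h' h⟩
  choose V hV using hex
  let B : ℤ := ((m + 1) ^ m : ℕ)
  let g : Matrix (Fin m) (Fin m) ℝ → ℤ × (Fin m → Fin m → ℤ) × Set (Fin m → ℤ) := fun Q =>
    ((V Q).det, fun i j => V Q i j % (V Q).det,
      ((V Q).adjugate *ᵥ ·) '' {v | quadVal Q v = 1})
  let S : Set (Matrix (Fin m) (Fin m) ℝ) := {Q | IsPerfectMinOne Q}
  have hbd : ∀ Q ∈ S, ∀ W : Matrix (Fin m) (Fin m) ℤ, (∀ j, quadVal Q (fun i => W i j) = 1) →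
      |W.det| ≤ B := by
    intro Q hQ W hW
    have := vf_det_bound hQ.2.1 hQ.2.2.1 W hW
    rw [Int.abs_eq_natAbs]
    simp only [B]
    exact_mod_cast this
  have hfin : (g '' S).Finite := by
    refine Set.Finite.subset ((Set.finite_Icc (-B) B).prod
      ((Set.finite_Icc (fun _ _ => (0:ℤ)) (fun _ _ => B)).prod
      (Set.finite_Icc (fun _ : Fin m => -B) (fun _ => B)).powerset)) ?_
    rintro _ ⟨Q, hQ, rfl⟩
    obtain ⟨hD, hV1⟩ := hV Q hQ
    have hb := hbd Q hQ _ hV1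
    refine ⟨abs_le.mp hb, ⟨fun i j => Int.emod_nonneg _ hD, fun i j => ?_⟩, ?_⟩
    · exact ((Int.emod_lt_abs _ hD).le.trans hb)
    · rintro _ ⟨w, hw, rfl⟩
      have key : ∀ i, |((V Q).adjugate *ᵥ w) i| ≤ B := by
        intro i
        rw [← Matrix.cramer_eq_adjugate_mulVec, Matrix.cramer_apply]
        apply hbd Q hQ
        intro j
        by_cases hj : j = i
        · subst hj
          simpa using hw
        · simpa [Matrix.updateCol_apply, hj] using hV1 j
      exact ⟨fun i => (abs_le.mp (key i)).1, fun i => (abs_le.mp (key i)).2⟩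
  obtain ⟨F, hFS, hF⟩ := Finset.subset_set_image_iff.mp
    (show (↑hfin.toFinset : Set _) ⊆ g '' S by simp)
  refine ⟨F, fun Q hQ => hFS hQ, fun Q hQ => ?_⟩
  have : g Q ∈ F.image g := by
    rw [hF]; simpa using ⟨Q, hQ, rfl⟩
  obtain ⟨Q', hQ', e⟩ := Finset.mem_image.mp this
  refine ⟨Q', hQ', ?_⟩
  have e1 := congrArg Prod.fst e
  have e2 := congrArg (fun x => x.2.1) e
  have e3 := congrArg (fun x => x.2.2) e
  exact vf_equiv hQ (hFS hQ') (V Q) (V Q') (hV Q hQ).1 e1.symm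
    (fun i j => (congrFun (congrFun e2 i) j).symm) e3.symm
end
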